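/- Fix a field F^t of a phase of the algorithm TC with corresponding changeset X_t and any tree cap D of X_t. (1) If F^t is positive, then req(F^t ∩ D) ≥ α·|D|. (2) If F^t is negative, then req(F^t ∩ (X_t \ D)) ≥ α·|X_t \ D|. -/

import Mathlib

open scoped Classical

/-!
Common setup for the online tree caching problem
(Bienkowski, Marcinkowski, Pacut, Schmid, Spyra, "Online Tree Caching").
-/

/-- A finite rooted tree on the vertex type `V`: every vertex has a parent,
the root is its own parent, and iterating `parent` from any vertex reaches the root. -/
structure RTree (V : Type) where
  root : V
  parent : V → V
  parent_root : parent root = root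
  reaches_root : ∀ v : V, ∃ n : ℕ, parent^[n] v = root

namespace RTree

variable {V : Type}

/-- The subtree `T(u)`: `u` together with all its descendants. -/
def subtree (T : RTree V) (u : V) : Set V :=
  {v | ∃ n : ℕ, T.parent^[n] v = u}

/-- `C` is a subforest of `T`: with every node it contains the whole subtree below it. -/
def Subforest (T : RTree V) (C : Set V) : Prop :=
  ∀ v ∈ C, T.subtree v ⊆ C

/-- `A` is a tree cap rooted at `v`: `A ⊆ T(v)`, `v ∈ A`, and `A` is closed under
taking the parent (towards `v`). -/
def TreeCap (T : RTree V) (v : V) (A : Set V) : Prop :=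
  A ⊆ T.subtree v ∧ v ∈ A ∧ ∀ u ∈ A, u ≠ v → T.parent u ∈ A

/-- `X` is a valid positive changeset for the cache `C`. -/
def ValidPos (T : RTree V) (C X : Set V) : Prop :=
  X.Nonempty ∧ X ∩ C = ∅ ∧ T.Subforest (C ∪ X)

/-- `X` is a valid negative changeset for the cache `C`. -/
def ValidNeg (T : RTree V) (C X : Set V) : Prop :=
  X.Nonempty ∧ X ⊆ C ∧ T.Subforest (C \ X)

/-- `X` is a valid changeset for the cache `C`. -/
def Valid (T : RTree V) (C X : Set V) : Prop :=
  T.ValidPos C X ∨ T.ValidNeg C X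

/-- `w` is the root of a tree (connected component) of the subforest `C`. -/
def IsCompRoot (T : RTree V) (C : Set V) (w : V) : Prop :=
  w ∈ C ∧ (w = T.root ∨ T.parent w ∉ C)

/-- The depth of a node: its distance to the root. -/
noncomputable def depth [DecidableEq V] (T : RTree V) (v : V) : ℕ :=
  Nat.find (T.reaches_root v)

/-- The height `h(T)` of the tree: its number of levels. -/
noncomputable def height [Fintype V] [DecidableEq V] (T : RTree V) : ℕ :=
  (Finset.univ.sup fun v => T.depth v) + 1

end RTree

/-- A request: a node together with a sign (`true` = positive, `false` = negative). -/
abbrev Request (V : Type) := V × Bool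

/-- The request `r` incurs cost `1` when the cache is `C`
(a positive request to a non-cached node, or a negative request to a cached node). -/
def Costly {V : Type} (r : Request V) (C : Set V) : Prop :=
  (r.2 = true ∧ r.1 ∉ C) ∨ (r.2 = false ∧ r.1 ∈ C)

/-- The sum of the counters `f` over the set of nodes `A`. -/
noncomputable def cntSum {V : Type} [Fintype V] (f : V → ℕ) (A : Set V) : ℕ :=
  ∑ v : V, A.indicator f v

/-- The number of nodes of a changeset (`0` for no changeset). -/
noncomputable def chgSize {V : Type} : Option (Set V) → ℕ
  | none => 0
  | some X => X.ncard

/-- One phase of the algorithm `TC` on the request sequence `req` (the request of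
round `t ≥ 1` is `req t`), starting at time `0` with an empty cache.
`cache t` is the cache contents during round `t`; `cnt t` are the counter values just
after serving the request of round `t` (used for the decision at time `t`);
`chg t` is the changeset applied at time `t` (right after round `t`), if any. -/
structure TCPhase {V : Type} [Fintype V] [DecidableEq V]
    (T : RTree V) (α : ℕ) (req : ℕ → Request V) where
  cache : ℕ → Set V
  cnt : ℕ → V → ℕ
  chg : ℕ → Option (Set V)
  cache_subforest : ∀ t, T.Subforest (cache t)
  cache_zero : cache 0 = ∅
  cnt_zero : ∀ v, cnt 0 v = 0
  cnt_rec : ∀ t v, cnt (t + 1) v =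
    (if ∃ X, chg t = some X ∧ v ∈ X then 0 else cnt t v)
    + (if (req (t + 1)).1 = v ∧ Costly (req (t + 1)) (cache (t + 1)) then 1 else 0)
  step_some : ∀ t X, chg t = some X →
    T.Valid (cache t) X ∧
    X.ncard * α ≤ cntSum (cnt t) X ∧
    (∀ Y, T.Valid (cache t) Y → X ⊂ Y → cntSum (cnt t) Y < Y.ncard * α) ∧
    cache (t + 1) = if T.ValidPos (cache t) X then cache t ∪ X else cache t \ X
  step_none : ∀ t, chg t = none →
    cache (t + 1) = cache t ∧
    ∀ X, T.Valid (cache t) X → cntSum (cnt t) X < X.ncard * α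

namespace TCPhase

variable {V : Type} [Fintype V] [DecidableEq V]
  {T : RTree V} {α : ℕ} {req : ℕ → Request V}

/-- The counter values at time `t`, right after the cache change at time `t`
(counters of fetched/evicted nodes are reset to `0`). -/
noncomputable def cntPost (E : TCPhase T α req) (t : ℕ) (v : V) : ℕ :=
  if ∃ X, E.chg t = some X ∧ v ∈ X then 0 else E.cnt t v

/-- `last_v(t)`: the last time strictly before `t` at which `v` changed its
cached/non-cached state (`0`, the beginning of the phase, if there is none). -/
noncomputable def lastChg (E : TCPhase T α req) (v : V) (t : ℕ) : ℕ :=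
  ((Finset.range t).filter fun s => ¬ ((v ∈ E.cache s) ↔ v ∈ E.cache (s + 1))).sup id

/-- The slot `(v, r)` belongs to the field `F^t`. -/
def inField (E : TCPhase T α req) (t : ℕ) (v : V) (r : ℕ) : Prop :=
  ∃ X, E.chg t = some X ∧ v ∈ X ∧ E.lastChg v t < r ∧ r ≤ t

/-- The number of requests of the sequence `ρ` lying in slots of `F^t_{≤ τ} ∩ D`. -/
noncomputable def fieldReqIn (E : TCPhase T α req) (ρ : ℕ → Request V)
    (t : ℕ) (D : Set V) (τ : ℕ) : ℕ :=
  ((Finset.Icc 1 t).filter fun r => r ≤ τ ∧ (ρ r).1 ∈ D ∧ E.inField t (ρ r).1 r).card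

/-- `req(F^t)`: the number of requests of `ρ` in slots of the field `F^t`. -/
noncomputable def fieldReq (E : TCPhase T α req) (ρ : ℕ → Request V) (t : ℕ) : ℕ :=
  E.fieldReqIn ρ t Set.univ t

/-- `size(F^t_{≤ τ} ∩ D)`: the number of distinct nodes having a slot in `F^t_{≤ τ} ∩ D`. -/
noncomputable def fieldSizeIn (E : TCPhase T α req) (t : ℕ) (D : Set V) (τ : ℕ) : ℕ :=
  (Finset.univ.filter fun v : V => v ∈ D ∧ ∃ r, r ≤ τ ∧ E.inField t v r).card

/-- The standing assumption: no positive requests are given to cached nodes and no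
negative requests to non-cached ones (so every request incurs cost `1` for `TC`). -/
def GoodReq (E : TCPhase T α req) : Prop :=
  ∀ t, 1 ≤ t →
    ((req t).2 = true → (req t).1 ∉ E.cache t) ∧
    ((req t).2 = false → (req t).1 ∈ E.cache t)

/-- The phase consists of rounds `1, …, tEnd`: no cache of `TC` before time `tEnd`
exceeds the capacity `kONL` (at time `tEnd` the triggered fetch, if any, is performed
even if it exceeds the capacity, and is followed by the final eviction). -/
def PhaseEnd (E : TCPhase T α req) (kONL tEnd : ℕ) : Prop :=
  ∀ t, t < tEnd → (E.cache (t + 1)).ncard ≤ kONL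

/-- `k_P`: the number of nodes in `TC`'s cache at the end of the phase
(after the fetch at time `tEnd`, before the final eviction). -/
noncomputable def kP (E : TCPhase T α req) (tEnd : ℕ) : ℕ :=
  (E.cache (tEnd + 1)).ncard

/-- The phase ending at `tEnd` is finished: the fetch at time `tEnd` exceeded the
capacity `kONL`. -/
def FinishedAt (E : TCPhase T α req) (kONL tEnd : ℕ) : Prop :=
  E.PhaseEnd kONL tEnd ∧ kONL < E.kP tEnd

/-- `size(𝓕)`: the total size of all fields of the phase. -/
noncomputable def sizeFields (E : TCPhase T α req) (tEnd : ℕ) : ℕ :=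
  ∑ t ∈ Finset.Icc 1 tEnd, chgSize (E.chg t)

/-- `req(F^∞)`: the number of requests of the phase lying in slots of the open field
(slots covered by no field of the phase). -/
noncomputable def openReq (E : TCPhase T α req) (tEnd : ℕ) : ℕ :=
  ((Finset.Icc 1 tEnd).filter fun r => ∀ t, t ≤ tEnd → ¬ E.inField t (req r).1 r).card

/-- `TC(P)`: the total cost paid by `TC` during the phase: serving the requests,
fetching/evicting the applied changesets (`α` per node), and the final eviction
(`α · k_P`) if the phase is finished. -/
noncomputable def tcCost (E : TCPhase T α req) (kONL tEnd : ℕ) : ℕ :=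
  ((Finset.Icc 1 tEnd).filter fun r => Costly (req r) (E.cache r)).card
  + α * E.sizeFields tEnd
  + (if kONL < E.kP tEnd then α * E.kP tEnd else 0)

/-- The tree cap `Y` (rooted at `u`, inside the negative field `F^t`) is proper for
the request sequence `ρ`: it holds `req(F^t ∩ Y) = |Y| · α`, and `F^t_{≤ τ} ∩ D` is
not over-requested for every tree cap `D ⊆ Y` rooted at `u` and every time `τ ≤ t`. -/
def Proper (E : TCPhase T α req) (ρ : ℕ → Request V) (t : ℕ) (u : V) (Y : Set V) : Prop :=
  E.fieldReqIn ρ t Y t = Y.ncard * α ∧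
  ∀ (D : Set V) (τ : ℕ), T.TreeCap u D → D ⊆ Y → τ ≤ t →
    E.fieldReqIn ρ t D τ ≤ E.fieldSizeIn t D τ * α

end TCPhase

/-- `D` is a feasible cache schedule for an (offline) algorithm with cache size `k`:
at every time the cache is a subforest of `T` of at most `k` nodes. -/
def IsSchedule {V : Type} (T : RTree V) (k : ℕ) (D : ℕ → Set V) : Prop :=
  ∀ t, T.Subforest (D t) ∧ (D t).ncard ≤ k

/-- The cost of serving the requests of rounds `a, …, b` of `ρ` when the cache during
round `r` is `D r`. -/
noncomputable def serveCost {V : Type} (ρ : ℕ → Request V) (D : ℕ → Set V) (a b : ℕ) : ℕ :=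
  ((Finset.Icc a b).filter fun r => Costly (ρ r) (D r)).card

/-- The reorganization cost of the schedule `D` (`α` per fetched or evicted node) over
the times `a, …, b - 1` (the change at time `t` leads from `D t` to `D (t+1)`). -/
noncomputable def moveCost {V : Type} (α : ℕ) (D : ℕ → Set V) (a b : ℕ) : ℕ :=
  α * ∑ t ∈ Finset.Ico a b, ((D (t + 1) \ D t).ncard + (D t \ D (t + 1)).ncard)

/-- `OPT`: the minimum cost of serving rounds `a, …, b` of `ρ` by an offline algorithm
with cache size `k` that may start with an arbitrary cache. -/
noncomputable def optCostFrom {V : Type} (T : RTree V) (α k : ℕ)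
    (ρ : ℕ → Request V) (a b : ℕ) : ℕ :=
  sInf {n | ∃ D : ℕ → Set V, IsSchedule T k D ∧
    n = serveCost ρ D a b + moveCost α D a b}

/-- `OPT`: the minimum cost of serving rounds `1, …, b` of `ρ` by an offline algorithm
with cache size `k` that starts with the empty cache. -/
noncomputable def optCostEmpty {V : Type} (T : RTree V) (α k : ℕ)
    (ρ : ℕ → Request V) (b : ℕ) : ℕ :=
  sInf {n | ∃ D : ℕ → Set V, IsSchedule T k D ∧ D 0 = ∅ ∧
    n = serveCost ρ D 1 b + moveCost α D 0 b}

/-- `ρ'` is obtained from `ρ` by legally shifting requests: signs are preserved, every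
positive request is moved to a descendant of its node (or kept), and every negative
request is moved to an ancestor of its node (or kept). -/
def LegalShift {V : Type} (T : RTree V) (ρ ρ' : ℕ → Request V) : Prop :=
  ∀ t, (ρ' t).2 = (ρ t).2 ∧
    ((ρ t).2 = true → (ρ' t).1 ∈ T.subtree (ρ t).1) ∧
    ((ρ t).2 = false → (ρ t).1 ∈ T.subtree (ρ' t).1)

/-- A full run of the algorithm `TC` with cache capacity `kONL` on the request
sequence `req`, including phase restarts: whenever the fetch of a saturated changeset
would exceed the capacity, `TC` instead evicts its whole cache and a new phase starts
(`newPhase t` holds, and all counters are reset). -/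
structure TCRun {V : Type} [Fintype V] [DecidableEq V]
    (T : RTree V) (α kONL : ℕ) (req : ℕ → Request V) where
  cache : ℕ → Set V
  cnt : ℕ → V → ℕ
  chg : ℕ → Option (Set V)
  newPhase : ℕ → Prop
  cache_subforest : ∀ t, T.Subforest (cache t)
  cache_zero : cache 0 = ∅
  cnt_zero : ∀ v, cnt 0 v = 0
  capacity : ∀ t, (cache t).ncard ≤ kONL
  cnt_rec : ∀ t v, cnt (t + 1) v =
    (if newPhase t ∨ ∃ X, chg t = some X ∧ v ∈ X then 0 else cnt t v)
    + (if (req (t + 1)).1 = v ∧ Costly (req (t + 1)) (cache (t + 1)) then 1 else 0)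
  step_some : ∀ t X, chg t = some X →
    T.Valid (cache t) X ∧
    X.ncard * α ≤ cntSum (cnt t) X ∧
    (∀ Y, T.Valid (cache t) Y → X ⊂ Y → cntSum (cnt t) Y < Y.ncard * α) ∧
    ((T.ValidPos (cache t) X ∧ (cache t ∪ X).ncard ≤ kONL ∧
        cache (t + 1) = cache t ∪ X ∧ ¬ newPhase t) ∨
     (T.ValidPos (cache t) X ∧ kONL < (cache t ∪ X).ncard ∧
        cache (t + 1) = ∅ ∧ newPhase t) ∨
     (T.ValidNeg (cache t) X ∧ cache (t + 1) = cache t \ X ∧ ¬ newPhase t))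
  step_none : ∀ t, chg t = none →
    cache (t + 1) = cache t ∧ ¬ newPhase t ∧
    ∀ X, T.Valid (cache t) X → cntSum (cnt t) X < X.ncard * α

/-- `TC(I)`: the total cost paid by the run `E` of `TC` on the rounds `1, …, N`:
serving the requests, plus `α` per fetched/evicted node (on a phase restart the whole
cache is evicted). -/
noncomputable def TCRun.cost {V : Type} [Fintype V] [DecidableEq V]
    {T : RTree V} {α kONL : ℕ} {req : ℕ → Request V}
    (E : TCRun T α kONL req) (N : ℕ) : ℕ :=
  ((Finset.Icc 1 N).filter fun r => Costly (req r) (E.cache r)).card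
  + α * ∑ t ∈ Finset.Icc 1 N,
      (if E.newPhase t then (E.cache t).ncard else chgSize (E.chg t))

namespace RTree

variable {V : Type}

lemma ancestor_antisymm (T : RTree V) {u w : V} (h₁ : w ∈ T.subtree u) (h₂ : u ∈ T.subtree w) :
    w = u := by
  obtain ⟨a, ha⟩ := h₁
  obtain ⟨b, hb⟩ := h₂
  rcases Nat.eq_zero_or_pos a with rfl | hpos
  · exact ha
  have hroot : ∀ n, T.parent^[n] T.root = T.root := Function.iterate_fixed T.parent_root
  have hcyc : T.parent^[b + a] w = w := by rw [Function.iterate_add_apply, ha, hb]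
  obtain ⟨n, hn⟩ := T.reaches_root w
  have hw : w = T.root := by
    have h := Function.iterate_fixed hcyc n
    rw [← Function.iterate_mul] at h
    obtain ⟨m, hm⟩ : ∃ m, (b + a) * n = m + n :=
      ⟨(b + a - 1) * n, by
        obtain ⟨c, rfl⟩ : ∃ c, a = c + 1 := ⟨a - 1, by omega⟩
        simp only [← add_assoc, Nat.add_sub_cancel]; ring⟩
    rw [hm, Function.iterate_add_apply, hn, hroot] at h
    exact h.symm
  rw [← ha, hw, hroot]

lemma TreeCap.mem_of_subtree {T : RTree V} {u w x : V} {D : Set V} (hD : T.TreeCap u D)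
    (hw : w ∈ T.subtree u) (hx : x ∈ D) (hxw : x ∈ T.subtree w) : w ∈ D := by
  obtain ⟨n, hn⟩ := hxw
  induction n generalizing x with
  | zero => exact (show x = w from hn) ▸ hx
  | succ n ih =>
    by_cases hxu : x = u
    · have h : w = u := T.ancestor_antisymm hw ⟨n + 1, hxu ▸ hn⟩
      exact h ▸ hD.2.1
    · exact ih (hD.2.2 x hx hxu) hn

lemma Subforest.inter {T : RTree V} {A B : Set V} (hA : T.Subforest A) (hB : T.Subforest B) :
    T.Subforest (A ∩ B) :=
  fun v hv => Set.subset_inter (hA v hv.1) (hB v hv.2)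

lemma Subforest.union {T : RTree V} {A B : Set V} (hA : T.Subforest A) (hB : T.Subforest B) :
    T.Subforest (A ∪ B) := by
  rintro v (hv | hv)
  · exact (hA v hv).trans Set.subset_union_left
  · exact (hB v hv).trans Set.subset_union_right

lemma Valid.nonempty {T : RTree V} {C X : Set V} (h : T.Valid C X) : X.Nonempty :=
  h.elim (·.1) (·.1)

lemma ValidPos.diff_treeCap {T : RTree V} {C X D : Set V} {u : V} (hX : T.ValidPos C X)
    (hC : T.Subforest C) (hXcap : T.TreeCap u X) (hD : T.TreeCap u D)
    (hne : (X \ D).Nonempty) : T.ValidPos C (X \ D) := by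
  refine ⟨hne, ?_, ?_⟩
  · rw [← Set.subset_empty_iff, ← hX.2.1]
    exact Set.inter_subset_inter_left _ Set.sdiff_subset
  · rintro w (hw | hw) x hx
    · exact Or.inl (hC w hw hx)
    · rcases hX.2.2 w (Or.inr hw.1) hx with h | h
      · exact Or.inl h
      · exact Or.inr ⟨h, fun hxD => hw.2 (hD.mem_of_subtree (hXcap.1 hw.1) hxD hx)⟩

lemma ValidNeg.treeCap {T : RTree V} {C X D : Set V} {u : V} (hX : T.ValidNeg C X)
    (hC : T.Subforest C) (hXcap : T.TreeCap u X) (hD : T.TreeCap u D) (hDX : D ⊆ X) :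
    T.ValidNeg C D := by
  refine ⟨⟨u, hD.2.1⟩, hDX.trans hX.2.1, ?_⟩
  intro w hw x hx
  refine ⟨hC w hw.1 hx, fun hxD => ?_⟩
  by_cases hwX : w ∈ X
  · exact hw.2 (hD.mem_of_subtree (hXcap.1 hwX) hxD hx)
  · exact (hX.2.2 w ⟨hw.1, hwX⟩ hx).2 (hDX hxD)

/-- A changeset valid after fetching `X` either extends `X` to a larger valid changeset, or
its part outside `X` was already valid. -/
lemma ValidPos.valid_union_or_diff {T : RTree V} {C X Y : Set V} (hX : T.ValidPos C X)
    (hC : T.Subforest C) (hY : T.Valid (C ∪ X) Y) :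
    (Disjoint X Y ∧ T.Valid C (X ∪ Y)) ∨ Y \ X = ∅ ∨ T.Valid C (Y \ X) := by
  have hXC := Set.disjoint_left.1 (Set.disjoint_iff_inter_eq_empty.2 hX.2.1)
  rcases hY with hY | hY
  · have hYC := Set.disjoint_left.1 (Set.disjoint_iff_inter_eq_empty.2 hY.2.1)
    refine Or.inl ⟨Set.disjoint_left.2 fun x hx hy => hYC hy (Or.inr hx), Or.inl
      ⟨hX.1.mono Set.subset_union_left, ?_, ?_⟩⟩
    · apply Set.disjoint_iff_inter_eq_empty.1
      refine Set.disjoint_left.2 ?_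
      rintro x (hx | hx) hxC
      exacts [hXC hx hxC, hYC hx (Or.inl hxC)]
    · rw [← Set.union_assoc]; exact hY.2.2
  · right
    rcases Set.eq_empty_or_nonempty (Y \ X) with h | h
    · exact Or.inl h
    refine Or.inr (Or.inr ⟨h, fun x hx => (hY.2.1 hx.1).resolve_right hx.2, ?_⟩)
    convert hC.inter hY.2.2 using 1
    ext x
    have := @hXC x
    simp only [Set.mem_sdiff, Set.mem_inter_iff, Set.mem_union]
    tauto

/-- A changeset valid after evicting `X` either extends `X` to a larger valid changeset, or
its part outside `X` was already valid. -/
lemma ValidNeg.valid_union_or_diff {T : RTree V} {C X Y : Set V} (hX : T.ValidNeg C X)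
    (hC : T.Subforest C) (hY : T.Valid (C \ X) Y) :
    (Disjoint X Y ∧ T.Valid C (X ∪ Y)) ∨ Y \ X = ∅ ∨ T.Valid C (Y \ X) := by
  have hXC := hX.2.1
  rcases hY with hY | hY
  · have hYC := Set.disjoint_left.1 (Set.disjoint_iff_inter_eq_empty.2 hY.2.1)
    right
    rcases Set.eq_empty_or_nonempty (Y \ X) with h | h
    · exact Or.inl h
    refine Or.inr (Or.inl ⟨h, ?_, ?_⟩)
    · apply Set.disjoint_iff_inter_eq_empty.1
      exact Set.disjoint_left.2 fun x hx hxC => hYC hx.1 ⟨hxC, hx.2⟩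
    · convert hC.union hY.2.2 using 1
      ext x
      have := @hXC x
      simp only [Set.mem_sdiff, Set.mem_union]
      tauto
  · refine Or.inl ⟨Set.disjoint_left.2 fun x hx hy => (hY.2.1 hy).2 hx, Or.inr
      ⟨hX.1.mono Set.subset_union_left,
        Set.union_subset hXC fun x hx => (hY.2.1 hx).1, ?_⟩⟩
    rw [← Set.sdiff_sdiff]; exact hY.2.2

end RTree

section cntSum

variable {V : Type} [Fintype V]

lemma cntSum_union (f : V → ℕ) {A B : Set V} (h : Disjoint A B) :
    cntSum f (A ∪ B) = cntSum f A + cntSum f B := by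
  simp only [cntSum, Set.indicator_union_of_disjoint h, Finset.sum_add_distrib]

lemma cntSum_add (f g : V → ℕ) (A : Set V) :
    cntSum (fun v => f v + g v) A = cntSum f A + cntSum g A := by
  simp only [cntSum, Set.indicator_add, Finset.sum_add_distrib]

lemma cntSum_single (w : V) (c : Prop) (A : Set V) :
    cntSum (fun v => if w = v ∧ c then 1 else 0) A = if w ∈ A ∧ c then 1 else 0 := by
  rw [cntSum, Finset.sum_eq_single w] <;>
    simp +contextual [Set.indicator_apply, ite_and, eq_comm]

end cntSum

namespace TCPhase

variable {V : Type} [Fintype V] [DecidableEq V]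
  {T : RTree V} {α : ℕ} {req : ℕ → Request V}

lemma valid_union_or_diff (E : TCPhase T α req) {t : ℕ} {X Y : Set V}
    (hchg : E.chg t = some X) (hY : T.Valid (E.cache (t + 1)) Y) :
    (Disjoint X Y ∧ T.Valid (E.cache t) (X ∪ Y)) ∨ Y \ X = ∅ ∨ T.Valid (E.cache t) (Y \ X) := by
  obtain ⟨hX, -, -, hcache⟩ := E.step_some t X hchg
  rw [hcache] at hY
  split_ifs at hY with hpos
  · exact hpos.valid_union_or_diff (E.cache_subforest t) hY
  · exact (hX.resolve_left hpos).valid_union_or_diff (E.cache_subforest t) hY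

lemma mem_cache_changes_iff (E : TCPhase T α req) (t : ℕ) (v : V) :
    (¬ (v ∈ E.cache t ↔ v ∈ E.cache (t + 1))) ↔ ∃ X, E.chg t = some X ∧ v ∈ X := by
  cases hchg : E.chg t with
  | none => simp [(E.step_none t hchg).1]
  | some X =>
    obtain ⟨hX, -, -, hcache⟩ := E.step_some t X hchg
    rw [hcache]
    split_ifs with hpos
    · have hXC := @Set.disjoint_left.1 (Set.disjoint_iff_inter_eq_empty.2 hpos.2.1) v
      simp only [Set.mem_union, Option.some.injEq, exists_eq_left']
      tauto
    · have hXC := @(hX.resolve_left hpos).2.1 v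
      simp only [Set.mem_sdiff, Option.some.injEq, exists_eq_left']
      tauto

lemma lastChg_succ (E : TCPhase T α req) (t : ℕ) (v : V) :
    E.lastChg v (t + 1) = if ∃ X, E.chg t = some X ∧ v ∈ X then t else E.lastChg v t := by
  simp only [lastChg, ← E.mem_cache_changes_iff, Finset.range_add_one, Finset.filter_insert]
  split_ifs with h
  · rfl
  · simp only [Finset.sup_insert, id, sup_eq_left, Finset.sup_le_iff, Finset.mem_filter,
      Finset.mem_range]
    exact fun s hs => hs.1.le

lemma lastChg_le (E : TCPhase T α req) (t : ℕ) (v : V) : E.lastChg v t ≤ t := by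
  simp only [lastChg, Finset.sup_le_iff, Finset.mem_filter, Finset.mem_range, id]
  exact fun s hs => hs.1.le

lemma costly_of_goodReq (E : TCPhase T α req) (hgood : E.GoodReq) {t : ℕ} (ht : 1 ≤ t) :
    Costly (req t) (E.cache t) := by
  have h := hgood t ht
  unfold Costly
  cases hs : (req t).2 <;> simp_all

/-- The counter of `v` is the number of requests at `v` since its last state change. -/
lemma cnt_eq_card (E : TCPhase T α req) (hgood : E.GoodReq) (t : ℕ) (v : V) :
    E.cnt t v =
      ((Finset.Icc 1 t).filter fun r => (req r).1 = v ∧ E.lastChg v t < r).card := by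
  induction t with
  | zero => simp [E.cnt_zero]
  | succ t ih =>
    have hlast := E.lastChg_le t v
    have hins : Finset.Icc 1 (t + 1) = insert (t + 1) (Finset.Icc 1 t) := by
      ext r; simp only [Finset.mem_Icc, Finset.mem_insert]; omega
    rw [E.cnt_rec, E.lastChg_succ, hins, Finset.filter_insert]
    simp only [E.costly_of_goodReq hgood (Nat.le_add_left 1 t), and_true]
    have hreset : (Finset.Icc 1 t).filter (fun r => (req r).1 = v ∧ t < r) = ∅ := by
      refine Finset.filter_eq_empty_iff.2 fun r hr h => ?_
      have := (Finset.mem_Icc.1 hr).2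
      omega
    by_cases hv : ∃ X, E.chg t = some X ∧ v ∈ X <;> by_cases hr : (req (t + 1)).1 = v
    · simp only [if_pos hv, hr, hreset]; simp
    · simp only [if_pos hv, hr, hreset]; simp
    · simp only [if_neg hv, hr, ih]
      simp only [if_true, true_and, Nat.lt_succ_of_le hlast]
      rw [Finset.card_insert_of_notMem (by simp)]
    · simp only [if_neg hv, hr, ih]; simp

lemma fieldReqIn_eq_cntSum (E : TCPhase T α req) (hgood : E.GoodReq) {t : ℕ} {X D : Set V}
    (hchg : E.chg t = some X) (hDX : D ⊆ X) :
    E.fieldReqIn req t D t = cntSum (E.cnt t) D := by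
  unfold fieldReqIn cntSum
  rw [Finset.card_eq_sum_card_fiberwise (f := fun r => (req r).1) (t := Finset.univ)
    (fun _ _ => Finset.mem_coe.2 (Finset.mem_univ _))]
  refine Finset.sum_congr rfl fun v _ => ?_
  rw [Finset.filter_filter]
  by_cases hv : v ∈ D
  · rw [Set.indicator_of_mem hv, E.cnt_eq_card hgood]
    congr 1
    refine Finset.filter_congr fun r hr => ?_
    have hrt := (Finset.mem_Icc.1 hr).2
    constructor
    · rintro ⟨⟨-, -, -, -, -, h, -⟩, rfl⟩
      exact ⟨rfl, h⟩
    · rintro ⟨rfl, h⟩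
      exact ⟨⟨hrt, hv, X, hchg, hDX hv, h, hrt⟩, rfl⟩
  · rw [Set.indicator_of_notMem hv, Finset.card_eq_zero]
    refine Finset.filter_eq_empty_iff.2 ?_
    rintro r - ⟨⟨-, h, -⟩, rfl⟩
    exact hv h

lemma cntSum_cntPost_le (E : TCPhase T α req) {t : ℕ} {X : Set V} (hchg : E.chg t = some X)
    (Y : Set V) : cntSum (E.cntPost t) Y ≤ cntSum (E.cnt t) (Y \ X) := by
  refine Finset.sum_le_sum fun v _ => ?_
  by_cases hY : v ∈ Y <;> by_cases hX : v ∈ X <;> simp [hY, hX, cntPost, hchg]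

lemma cntSum_cnt_succ (E : TCPhase T α req) (t : ℕ) (Y : Set V) :
    cntSum (E.cnt (t + 1)) Y = cntSum (E.cntPost t) Y +
      if (req (t + 1)).1 ∈ Y ∧ Costly (req (t + 1)) (E.cache (t + 1)) then 1 else 0 := by
  rw [← cntSum_single, ← cntSum_add]
  congr 1
  funext v
  rw [E.cnt_rec, cntPost]
  congr!

/-- If a saturated valid changeset is disjoint from another valid one, the latter is not
saturated, provided no valid changeset was saturated before the round. -/
lemma cntSum_lt_of_disjoint_saturated (E : TCPhase T α req) {t : ℕ}
    (hpost : ∀ Y, T.Valid (E.cache (t + 1)) Y → cntSum (E.cntPost t) Y < Y.ncard * α)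
    {X Z : Set V} (hX : T.Valid (E.cache (t + 1)) X) (hZ : T.Valid (E.cache (t + 1)) Z)
    (hdisj : Disjoint X Z) (hsat : X.ncard * α ≤ cntSum (E.cnt (t + 1)) X) :
    cntSum (E.cnt (t + 1)) Z < Z.ncard * α := by
  have hX' := hpost X hX
  have hZ' := hpost Z hZ
  rw [E.cntSum_cnt_succ] at hsat ⊢
  by_cases hr : (req (t + 1)).1 ∈ X
  · simpa [Set.disjoint_left.1 hdisj hr] using hZ'
  · simp only [hr, false_and, if_false] at hsat
    omega

/-- Right after the cache change at any time no valid changeset is saturated. -/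
lemma cntSum_cntPost_lt (E : TCPhase T α req) (hα : 1 ≤ α) (t : ℕ) :
    ∀ Y, T.Valid (E.cache (t + 1)) Y → cntSum (E.cntPost t) Y < Y.ncard * α := by
  have hcard : ∀ {Y : Set V}, Y.Nonempty → 0 < Y.ncard * α := fun hY =>
    Nat.mul_pos ((Set.ncard_pos (Set.toFinite _)).2 hY) hα
  induction t with
  | zero =>
    intro Y hY
    convert hcard hY.nonempty
    simp [cntSum, cntPost, E.cnt_zero, Set.indicator_apply]
  | succ t ih =>
    intro Y hY
    cases hchg : E.chg (t + 1) with
    | none =>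
      obtain ⟨hcache, hlt⟩ := E.step_none _ hchg
      have hp : E.cntPost (t + 1) = E.cnt (t + 1) := by
        funext v; simp [cntPost, hchg]
      rw [hp]
      exact hlt Y (hcache ▸ hY)
    | some X =>
      obtain ⟨hX, hsat, hmax, -⟩ := E.step_some _ X hchg
      refine (E.cntSum_cntPost_le hchg Y).trans_lt ?_
      rcases E.valid_union_or_diff hchg hY with ⟨hdisj, hU⟩ | hempty | hZ
      · have hlt := hmax _ hU (Set.ssubset_iff_subset_ne.2 ⟨Set.subset_union_left, fun h => by
          obtain ⟨y, hy⟩ := hY.nonempty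
          exact Set.disjoint_left.1 hdisj (h ▸ Or.inr hy) hy⟩)
        rw [cntSum_union _ hdisj, Set.ncard_union_eq hdisj, add_mul] at hlt
        rw [hdisj.symm.sdiff_eq_left]
        omega
      · rw [hempty]
        simpa [cntSum] using hcard hY.nonempty
      · exact (E.cntSum_lt_of_disjoint_saturated ih hX hZ disjoint_sdiff_self_right
          hsat).trans_le (Nat.mul_le_mul_right _ (Set.ncard_le_ncard Set.sdiff_subset))

/-- A valid changeset is never over-requested. -/
lemma cntSum_cnt_le (E : TCPhase T α req) (hα : 1 ≤ α) (t : ℕ) {Y : Set V}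
    (hY : T.Valid (E.cache t) Y) : cntSum (E.cnt t) Y ≤ Y.ncard * α := by
  cases t with
  | zero => simp [cntSum, E.cnt_zero, Set.indicator_apply]
  | succ t =>
    have h := E.cntSum_cntPost_lt hα t Y hY
    rw [E.cntSum_cnt_succ]
    split_ifs <;> omega

end TCPhase

/-- fix a field `F^t` with changeset `X_t` and a tree cap `D` of `X_t`.
(1) If `F^t` is positive then `req(F^t ∩ D) ≥ α·|D|`.
(2) If `F^t` is negative then `req(F^t ∩ (X_t \ D)) ≥ α·|X_t \ D|`. -/
theorem field_request_density {V : Type} [Fintype V] [DecidableEq V]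
    {T : RTree V} {α : ℕ} {req : ℕ → Request V}
    (E : TCPhase T α req) (hα : 1 ≤ α) (hgood : E.GoodReq)
    (t : ℕ) (X : Set V) (hchg : E.chg t = some X)
    (u : V) (D : Set V) (hXcap : T.TreeCap u X) (hDcap : T.TreeCap u D) (hDX : D ⊆ X) :
    (T.ValidPos (E.cache t) X → α * D.ncard ≤ E.fieldReqIn req t D t) ∧
    (T.ValidNeg (E.cache t) X → α * (X \ D).ncard ≤ E.fieldReqIn req t (X \ D) t) := by
  obtain ⟨-, hsat, -, -⟩ := E.step_some t X hchg
  have hC := E.cache_subforest t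
  have hdisj : Disjoint D (X \ D) := disjoint_sdiff_self_right
  rw [← Set.union_sdiff_cancel hDX, cntSum_union _ hdisj, Set.ncard_union_eq hdisj, add_mul,
    mul_comm, mul_comm (X \ D).ncard] at hsat
  rw [E.fieldReqIn_eq_cntSum hgood hchg hDX, E.fieldReqIn_eq_cntSum hgood hchg Set.sdiff_subset]
  refine ⟨fun hpos => ?_, fun hneg => ?_⟩
  · rcases Set.eq_empty_or_nonempty (X \ D) with hempty | hne
    · simpa [hempty, cntSum] using hsat
    · have := E.cntSum_cnt_le hα t (Or.inl (hpos.diff_treeCap hC hXcap hDcap hne))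
      rw [mul_comm] at this
      omega
  · have := E.cntSum_cnt_le hα t (Or.inr (hneg.treeCap hC hXcap hDcap hDX))
    rw [mul_comm] at this
    omega
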